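/- Consider the online uniform label noise model with noise rate ε ∈ (0,1) and α ∈ (0,1). Let η > 0 be a constant learning rate, τ̂_1 ∈ [0,1] a deterministic initial threshold, and update τ̂_{t+1} = τ̂_t − η·g̃(τ̂_t, S̃_t, (S_{t,y})_{y=1}^K). Then for every δ ∈ (0,1) and integer T ≥ 1, with probability at least 1−δ, the empirical coverage error satisfies | (1/T)·Σ_{t=1}^T 1{S_t > τ̂_t} − α | ≤ ((2−ε)/(1−ε))·√(2·log(4/δ))·T^{−1/2} + (1/η + (1+ε)/(1−ε))·T^{−1}. -/

import Mathlib

open MeasureTheory ProbabilityTheory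

/-- The robust pinball subgradient. -/
noncomputable def robustGrad (α ε : ℝ) (K : ℕ) (τ stil : ℝ) (s : Fin K → ℝ) : ℝ :=
  (1 / (1 - ε)) * ((if stil ≤ τ then (1:ℝ) else 0) - (1 - α))
    - (ε / ((K : ℝ) * (1 - ε))) * ∑ y : Fin K, ((if s y ≤ τ then (1:ℝ) else 0) - (1 - α))

lemma azuma_mgf {Ω : Type*} {m0 : MeasurableSpace Ω} (μ : Measure Ω) [IsProbabilityMeasure μ]
    (F : Filtration ℕ m0) (D : ℕ → Ω → ℝ) (c : ℝ) (hc : 0 < c)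
    (hmeas : ∀ t, 1 ≤ t → Measurable[F t] (D t)) (hb : ∀ t, 1 ≤ t → ∀ ω, |D t ω| ≤ c)
    (hz : ∀ t, 1 ≤ t → ∀ W : Ω → ℝ, Measurable[F (t-1)] W → (∃ C, ∀ ω, |W ω| ≤ C) →
      ∫ ω, W ω * D t ω ∂μ = 0) (l : ℝ) (n : ℕ) :
    Measurable[F n] (fun ω => ∑ t ∈ Finset.Icc 1 n, D t ω) ∧
    (∀ ω, |∑ t ∈ Finset.Icc 1 n, D t ω| ≤ n * c) ∧
    Integrable (fun ω => Real.exp (l * ∑ t ∈ Finset.Icc 1 n, D t ω)) μ ∧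
    ∫ ω, Real.exp (l * ∑ t ∈ Finset.Icc 1 n, D t ω) ∂μ ≤ Real.exp (n * c^2 * l^2 / 2) := by
  have hbd : ∀ n : ℕ, ∀ ω, |∑ t ∈ Finset.Icc 1 n, D t ω| ≤ n * c := by
    intro n ω
    refine (Finset.abs_sum_le_sum_abs _ _).trans ?_
    refine (Finset.sum_le_card_nsmul _ _ c ?_).trans ?_
    · intro t ht; exact hb t (Finset.mem_Icc.1 ht).1 ω
    · simp
  have hm : ∀ n : ℕ, Measurable[F n] (fun ω => ∑ t ∈ Finset.Icc 1 n, D t ω) := by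
    intro n
    refine Finset.measurable_fun_sum _ ?_
    intro t ht
    exact (hmeas t (Finset.mem_Icc.1 ht).1).mono (F.mono (Finset.mem_Icc.1 ht).2) le_rfl
  have hme : ∀ n : ℕ, Measurable[F n] (fun ω => Real.exp (l * ∑ t ∈ Finset.Icc 1 n, D t ω)) := by
    intro n
    exact Real.measurable_exp.comp ((hm n).const_mul l)
  have heb : ∀ n : ℕ, ∀ ω, |Real.exp (l * ∑ t ∈ Finset.Icc 1 n, D t ω)| ≤ Real.exp (|l| * (n * c)) := by
    intro n ω
    rw [abs_of_pos (Real.exp_pos _)]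
    apply Real.exp_le_exp.2
    refine (le_abs_self _).trans ?_
    rw [abs_mul]
    exact mul_le_mul_of_nonneg_left (hbd n ω) (abs_nonneg _)
  have hint : ∀ n : ℕ, Integrable (fun ω => Real.exp (l * ∑ t ∈ Finset.Icc 1 n, D t ω)) μ := by
    intro n
    exact Integrable.of_bound ((hme n).mono (F.le n) le_rfl).aestronglyMeasurable _
      (Filter.Eventually.of_forall (fun ω => heb n ω))
  refine ⟨hm n, hbd n, hint n, ?_⟩
  induction n with
  | zero => simp
  | succ n ih =>
    have hD := (hmeas (n+1) (by omega)).mono (F.le (n+1)) le_rfl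
    have hint2 : Integrable (fun ω => Real.exp (l * ∑ t ∈ Finset.Icc 1 n, D t ω) * D (n+1) ω) μ := by
      refine (hint n).mul_bdd (c := c) hD.aestronglyMeasurable
        (Filter.Eventually.of_forall (fun ω => hb (n+1) (by omega) ω))
    have key : ∀ x : ℝ, |x| ≤ c → Real.exp (l * x) ≤ Real.cosh (l*c) + Real.sinh (l*c) / c * x := by
      intro x hx
      have h1 := abs_le.1 hx
      have ha : 0 ≤ (c - x)/(2*c) := div_nonneg (by linarith) (by linarith)
      have hb' : 0 ≤ (c + x)/(2*c) := div_nonneg (by linarith) (by linarith)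
      have := convexOn_exp.2 (Set.mem_univ (-(l*c))) (Set.mem_univ (l*c)) ha hb'
        (by field_simp; ring)
      simp only [smul_eq_mul] at this
      have e1 : (c - x)/(2*c) * (-(l*c)) + (c+x)/(2*c) * (l*c) = l * x := by field_simp; ring
      rw [e1] at this
      refine this.trans (le_of_eq ?_)
      rw [Real.cosh_eq, Real.sinh_eq]
      field_simp
      ring
    have hstep : ∫ ω, Real.exp (l * ∑ t ∈ Finset.Icc 1 (n+1), D t ω) ∂μ ≤
        ∫ ω, (Real.cosh (l*c) * Real.exp (l * ∑ t ∈ Finset.Icc 1 n, D t ω) +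
          Real.sinh (l*c) / c * (Real.exp (l * ∑ t ∈ Finset.Icc 1 n, D t ω) * D (n+1) ω)) ∂μ := by
      apply integral_mono (hint (n+1)) ((hint n).const_mul _ |>.add (hint2.const_mul _))
      intro ω
      simp only
      rw [Finset.sum_Icc_succ_top (by omega), mul_add, Real.exp_add]
      have := mul_le_mul_of_nonneg_left (key _ (hb (n+1) (by omega) ω))
        (Real.exp_pos (l * ∑ t ∈ Finset.Icc 1 n, D t ω)).le
      refine this.trans (le_of_eq ?_)
      simp only [Pi.add_apply]
      ring
    rw [integral_add ((hint n).const_mul _) (hint2.const_mul _), integral_const_mul,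
      integral_const_mul, hz (n+1) (by omega) _ (hme n) ⟨_, heb n⟩, mul_zero, add_zero] at hstep
    refine hstep.trans ?_
    refine (mul_le_mul (Real.cosh_le_exp_half_sq _) ih (integral_nonneg fun _ => (Real.exp_pos _).le)
      (Real.exp_pos _).le).trans (le_of_eq ?_)
    rw [← Real.exp_add]
    push_cast
    ring_nf

lemma azuma_tail {Ω : Type*} {m0 : MeasurableSpace Ω} (μ : Measure Ω) [IsProbabilityMeasure μ]
    (F : Filtration ℕ m0) (D : ℕ → Ω → ℝ) (c : ℝ) (hc : 0 < c)
    (hmeas : ∀ t, 1 ≤ t → Measurable[F t] (D t)) (hb : ∀ t, 1 ≤ t → ∀ ω, |D t ω| ≤ c)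
    (hz : ∀ t, 1 ≤ t → ∀ W : Ω → ℝ, Measurable[F (t-1)] W → (∃ C, ∀ ω, |W ω| ≤ C) →
      ∫ ω, W ω * D t ω ∂μ = 0) (n : ℕ) (x : ℝ) (hx : 0 ≤ x) :
    μ.real {ω | x ≤ |∑ t ∈ Finset.Icc 1 n, D t ω|} ≤ 2 * Real.exp (-x^2 / (2 * (n * c^2))) := by
  have hs : HasSubgaussianMGF (fun ω => ∑ t ∈ Finset.Icc 1 n, D t ω)
      ⟨n * c^2, by positivity⟩ μ := by
    refine ⟨fun l => (azuma_mgf μ F D c hc hmeas hb hz l n).2.2.1, fun l => ?_⟩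
    exact (azuma_mgf μ F D c hc hmeas hb hz l n).2.2.2
  have h1 := hs.measure_ge_le hx
  have h2 := hs.neg.measure_ge_le hx
  have hsub : {ω | x ≤ |∑ t ∈ Finset.Icc 1 n, D t ω|} ⊆
      {ω | x ≤ ∑ t ∈ Finset.Icc 1 n, D t ω} ∪
      {ω | x ≤ (-(fun ω => ∑ t ∈ Finset.Icc 1 n, D t ω)) ω} := by
    intro ω hω
    have hω' : x ≤ |∑ t ∈ Finset.Icc 1 n, D t ω| := hω
    exact le_abs.1 hω'
  have h3 := (measureReal_mono (μ := μ) hsub).trans (measureReal_union_le _ _)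
  refine h3.trans ?_
  rw [two_mul]
  exact add_le_add h1 h2

lemma meas_select {Ω : Type*} {m : MeasurableSpace Ω} {K : ℕ} (Y : Ω → Fin K) (S : Fin K → Ω → ℝ)
    (hY : Measurable Y) (hS : ∀ y, Measurable (S y)) : Measurable (fun ω => S (Y ω) ω) := by
  intro s hs
  have : (fun ω => S (Y ω) ω) ⁻¹' s = ⋃ y, (Y ⁻¹' {y} ∩ S y ⁻¹' s) := by
    ext ω; simp
  rw [this]
  exact MeasurableSet.iUnion fun y => (hY (measurableSet_singleton y)).inter (hS y hs)

lemma indep_set_integral {Ω : Type*} {m0 : MeasurableSpace Ω} (μ : Measure Ω)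
    [IsProbabilityMeasure μ] (m1 m2 : MeasurableSpace Ω) (h1 : m1 ≤ m0) (h2 : m2 ≤ m0)
    (h : Indep m1 m2 μ) (A : Set Ω) (hA : MeasurableSet[m1] A) (f : Ω → ℝ) (hf : Measurable[m2] f) :
    ∫ ω, A.indicator (fun _ => (1:ℝ)) ω * f ω ∂μ = μ.real A * ∫ ω, f ω ∂μ := by
  have hi : IndepFun (A.indicator (fun _ => (1:ℝ))) f μ := by
    rw [IndepFun_iff_Indep]
    refine indep_of_indep_of_le_left (indep_of_indep_of_le_right h hf.comap_le) ?_
    exact Measurable.comap_le (measurable_const.indicator hA)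
  rw [hi.integral_fun_mul_eq_mul_integral
    (measurable_const.indicator (h1 _ hA)).aestronglyMeasurable
    (hf.mono h2 le_rfl).aestronglyMeasurable, integral_indicator (h1 _ hA)]
  simp

lemma pair_meas {Ω : Type*} {m : MeasurableSpace Ω} {K : ℕ} (Y : Ω → Fin K) (S : Fin K → Ω → ℝ)
    (hY : Measurable Y) (hS : ∀ y, Measurable (S y)) :
    Measurable (fun ω => (Y ω, fun y => S y ω)) :=
  hY.prodMk (measurable_pi_lambda _ hS)

/-- Simplified form of the robust gradient. -/
lemma robustGrad_eq (α ε : ℝ) (K : ℕ) (hK : 1 ≤ K) (hε : ε ∈ Set.Ioo (0:ℝ) 1) (τ st : ℝ)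
    (s : Fin K → ℝ) :
    robustGrad α ε K τ st s = (1 / (1 - ε)) * (if st ≤ τ then (1:ℝ) else 0)
      - (ε / ((K : ℝ) * (1 - ε))) * (∑ y : Fin K, (if s y ≤ τ then (1:ℝ) else 0)) - (1 - α) := by
  unfold robustGrad
  rw [Finset.sum_sub_distrib]
  have h1 : (1 - ε) ≠ 0 := by linarith [hε.2]
  have h2 : (K:ℝ) ≠ 0 := by positivity
  simp only [Finset.sum_const, Finset.card_univ, Fintype.card_fin, nsmul_eq_mul]
  field_simp
  ring

lemma avg_bounds (ε : ℝ) (K : ℕ) (hK : 1 ≤ K) (hε : ε ∈ Set.Ioo (0:ℝ) 1) (τ : ℝ)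
    (s : Fin K → ℝ) :
    0 ≤ (ε / ((K : ℝ) * (1 - ε))) * (∑ y : Fin K, (if s y ≤ τ then (1:ℝ) else 0)) ∧
    (ε / ((K : ℝ) * (1 - ε))) * (∑ y : Fin K, (if s y ≤ τ then (1:ℝ) else 0)) ≤ ε / (1 - ε) := by
  have h1 : 0 < (1 - ε) := by linarith [hε.2]
  have h0 := hε.1
  have h2 : 0 < (K:ℝ) := by positivity
  have h3 : (∑ y : Fin K, (if s y ≤ τ then (1:ℝ) else 0)) ≤ K := by
    refine (Finset.sum_le_card_nsmul _ _ 1 ?_).trans (by simp)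
    intro y _; split_ifs <;> norm_num
  constructor
  · refine mul_nonneg (by positivity) (Finset.sum_nonneg fun y _ => ?_)
    split_ifs <;> norm_num
  · calc _ ≤ (ε / ((K : ℝ) * (1 - ε))) * K := mul_le_mul_of_nonneg_left h3 (by positivity)
      _ = _ := by field_simp

lemma one_div_sub (ε : ℝ) (hε : ε ∈ Set.Ioo (0:ℝ) 1) : 1 / (1 - ε) = 1 + ε / (1 - ε) := by
  have h1 : (1 - ε) ≠ 0 := by linarith [hε.2]
  field_simp
  ring

lemma robustGrad_bound (α ε : ℝ) (K : ℕ) (hK : 1 ≤ K) (hε : ε ∈ Set.Ioo (0:ℝ) 1)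
    (hα : α ∈ Set.Ioo (0:ℝ) 1) (τ st : ℝ) (s : Fin K → ℝ) :
    |robustGrad α ε K τ st s| ≤ 1 / (1 - ε) := by
  rw [robustGrad_eq α ε K hK hε, one_div_sub ε hε]
  obtain ⟨h1, h2⟩ := avg_bounds ε K hK hε τ s
  have := hα.1
  have := hα.2
  rw [abs_le]
  split_ifs <;> constructor <;> linarith

lemma diff_bound (α ε : ℝ) (K : ℕ) (hK : 1 ≤ K) (hε : ε ∈ Set.Ioo (0:ℝ) 1)
    (τ st r : ℝ) (s : Fin K → ℝ) :
    |robustGrad α ε K τ st s - ((if r ≤ τ then (1:ℝ) else 0) - (1 - α))| ≤ (2 - ε) / (1 - ε) := by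
  have h4 : (2 - ε) / (1 - ε) = 2 + ε / (1 - ε) := by
    have h1 : (1 - ε) ≠ 0 := by linarith [hε.2]
    field_simp
    ring
  rw [robustGrad_eq α ε K hK hε, one_div_sub ε hε, h4]
  obtain ⟨h1, h2⟩ := avg_bounds ε K hK hε τ s
  rw [abs_le]
  split_ifs <;> constructor <;> linarith

lemma robustGrad_low (α ε : ℝ) (K : ℕ) (hK : 1 ≤ K) (hε : ε ∈ Set.Ioo (0:ℝ) 1)
    (τ : ℝ) (s : Fin K → ℝ) (y : Fin K) (hs : ∀ y, s y ∈ Set.Icc (0:ℝ) 1) (hτ : τ < 0) :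
    robustGrad α ε K τ (s y) s = -(1 - α) := by
  rw [robustGrad_eq α ε K hK hε]
  have : ∀ y, ¬ (s y ≤ τ) := fun y => by linarith [(hs y).1]
  simp [this]

lemma robustGrad_high (α ε : ℝ) (K : ℕ) (hK : 1 ≤ K) (hε : ε ∈ Set.Ioo (0:ℝ) 1)
    (τ : ℝ) (s : Fin K → ℝ) (y : Fin K) (hs : ∀ y, s y ∈ Set.Icc (0:ℝ) 1) (hτ : 1 < τ) :
    robustGrad α ε K τ (s y) s = α := by
  rw [robustGrad_eq α ε K hK hε]
  have : ∀ y, (s y ≤ τ) := fun y => by linarith [(hs y).2]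
  have h1 : (1 - ε) ≠ 0 := by linarith [hε.2]
  have h2 : (K:ℝ) ≠ 0 := by positivity
  simp [this]
  field_simp
  ring

lemma bdd_mul_ite {Ω : Type*} {m0 : MeasurableSpace Ω} (μ : Measure Ω)
    [IsProbabilityMeasure μ] (W r τ : Ω → ℝ) (C : ℝ) (hW : ∀ ω, |W ω| ≤ C)
    (hWm : Measurable W) (hr : Measurable r) (hτ : Measurable τ) :
    Measurable (fun ω => W ω * (if r ω ≤ τ ω then (1:ℝ) else 0)) ∧
    Integrable (fun ω => W ω * (if r ω ≤ τ ω then (1:ℝ) else 0)) μ := by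
  have h : Measurable (fun ω => W ω * (if r ω ≤ τ ω then (1:ℝ) else 0)) :=
    hWm.mul (Measurable.ite (measurableSet_le hr hτ) measurable_const measurable_const)
  refine ⟨h, Integrable.of_bound h.aestronglyMeasurable C (Filter.Eventually.of_forall fun ω => ?_)⟩
  have := (abs_nonneg _).trans (hW ω)
  split_ifs
  · simpa using hW ω
  · simpa using this

lemma zero_mean {Ω : Type*} (G : MeasurableSpace Ω) {m0 : MeasurableSpace Ω} (μ : Measure Ω)
    [IsProbabilityMeasure μ] (hG : G ≤ m0)
    (K : ℕ) (hK : 1 ≤ K) (ε α : ℝ) (hε : ε ∈ Set.Ioo (0:ℝ) 1)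
    (S : Fin K → Ω → ℝ) (Y : Ω → Fin K) (U : Ω → ℝ) (Ybar : Ω → Fin K)
    (hS : ∀ y, Measurable[G] (S y)) (hY : Measurable[G] Y)
    (hU_meas : Measurable U) (hYbar_meas : Measurable Ybar)
    (hU_unif : Measure.map U μ = volume.restrict (Set.Icc (0:ℝ) 1))
    (hYbar_unif : ∀ y : Fin K, μ {ω | Ybar ω = y} = (K : ENNReal)⁻¹)
    (hIndep : iIndep ![MeasurableSpace.comap U inferInstance,
          MeasurableSpace.comap Ybar inferInstance, G] μ)
    (τ : Ω → ℝ) (hτ : Measurable[G] τ) (W : Ω → ℝ) (hW : Measurable[G] W)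
    (C : ℝ) (hC : ∀ ω, |W ω| ≤ C) :
    ∫ ω, W ω * (robustGrad α ε K (τ ω) (S (if ε ≤ U ω then Y ω else Ybar ω) ω) (fun y => S y ω)
      - ((if S (Y ω) ω ≤ τ ω then (1:ℝ) else 0) - (1 - α))) ∂μ = 0 := by
  have hle : ∀ i, (![MeasurableSpace.comap U inferInstance,
          MeasurableSpace.comap Ybar inferInstance, G] : Fin 3 → MeasurableSpace Ω) i ≤ m0 := by
    intro i
    fin_cases i
    · exact hU_meas.comap_le
    · exact hYbar_meas.comap_le
    · exact hG
  have hUG : Indep (MeasurableSpace.comap U inferInstance) G μ :=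
    hIndep.indep (i := 0) (j := 2) (by decide)
  have hUY : Indep (MeasurableSpace.comap U inferInstance)
      (MeasurableSpace.comap Ybar inferInstance) μ :=
    hIndep.indep (i := 0) (j := 1) (by decide)
  have hUYG : Indep (MeasurableSpace.comap U inferInstance ⊔
      MeasurableSpace.comap Ybar inferInstance) G μ := by
    have := indep_iSup_of_disjoint hle hIndep (S := {0, 1}) (T := {2}) (by simp)
    simpa [iSup_insert, iSup_or, iSup_sup_eq] using this
  -- the events
  set A : Set Ω := U ⁻¹' Set.Ici ε with hA
  set A' : Set Ω := U ⁻¹' Set.Iio ε with hA'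
  have hPA : μ.real A = 1 - ε := by
    have h1 : Set.Ici ε ∩ Set.Icc (0:ℝ) 1 = Set.Icc ε 1 := by
      ext x; simp only [Set.mem_inter_iff, Set.mem_Ici, Set.mem_Icc]
      constructor
      · rintro ⟨a, b, c⟩; exact ⟨a, c⟩
      · rintro ⟨a, c⟩; exact ⟨a, by linarith [hε.1], c⟩
    rw [measureReal_def, hA, ← Measure.map_apply hU_meas measurableSet_Ici, hU_unif,
      Measure.restrict_apply measurableSet_Ici, h1, Real.volume_Icc,
      ENNReal.toReal_ofReal (by linarith [hε.2])]
  have hPA' : μ.real A' = ε := by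
    have : A' = Aᶜ := by ext ω; simp [hA, hA']
    rw [this, probReal_compl_eq_one_sub (hU_meas measurableSet_Ici), hPA]; ring
  have hPB : ∀ y, μ.real (A' ∩ Ybar ⁻¹' {y}) = ε / K := by
    intro y
    have h1 := (Indep_iff _ _ μ).1 hUY A' (Ybar ⁻¹' {y}) ⟨_, measurableSet_Iio, rfl⟩
      ⟨_, measurableSet_singleton y, rfl⟩
    have h2 : μ (Ybar ⁻¹' {y}) = (K : ENNReal)⁻¹ := hYbar_unif y
    rw [measureReal_def, h1, ENNReal.toReal_mul, ← measureReal_def, hPA', h2]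
    simp [div_eq_mul_inv]
  have hSY : Measurable[G] (fun ω => S (Y ω) ω) := meas_select Y S hY hS
  have hW0 : Measurable W := hW.mono hG le_rfl
  -- the G-measurable integrands
  set f : Fin K → Ω → ℝ := fun y ω => W ω * (if S y ω ≤ τ ω then (1:ℝ) else 0) with hf
  set g : Ω → ℝ := fun ω => W ω * (if S (Y ω) ω ≤ τ ω then (1:ℝ) else 0) with hg
  have hfm : ∀ y, Measurable[G] (f y) := fun y =>
    hW.mul (Measurable.ite (measurableSet_le (hS y) hτ) measurable_const measurable_const)
  have hgm : Measurable[G] g :=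
    hW.mul (Measurable.ite (measurableSet_le hSY hτ) measurable_const measurable_const)
  have hfi : ∀ y, Integrable (f y) μ := fun y =>
    (bdd_mul_ite μ W (S y) τ C hC hW0 ((hS y).mono hG le_rfl) (hτ.mono hG le_rfl)).2
  have hgi : Integrable g μ :=
    (bdd_mul_ite μ W _ τ C hC hW0 (hSY.mono hG le_rfl) (hτ.mono hG le_rfl)).2
  have hind : ∀ B : Set Ω, MeasurableSet B → ∀ h : Ω → ℝ, Integrable h μ →
      Integrable (fun ω => B.indicator (fun _ => (1:ℝ)) ω * h ω) μ := by
    intro B hB h hh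
    have : (fun ω => B.indicator (fun _ => (1:ℝ)) ω * h ω) = B.indicator h := by
      ext ω; by_cases hω : ω ∈ B <;> simp [hω]
    rw [this]; exact hh.indicator hB
  have hAm : MeasurableSet A := hU_meas measurableSet_Ici
  have hBm : ∀ y, MeasurableSet (A' ∩ Ybar ⁻¹' {y}) := fun y =>
    (hU_meas measurableSet_Iio).inter (hYbar_meas (measurableSet_singleton y))
  have hi1 : ∫ ω, A.indicator (fun _ => (1:ℝ)) ω * g ω ∂μ = (1 - ε) * ∫ ω, g ω ∂μ := by
    rw [indep_set_integral μ _ G hU_meas.comap_le hG hUG A ⟨_, measurableSet_Ici, rfl⟩ g hgm, hPA]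
  have hi2 : ∀ y, ∫ ω, (A' ∩ Ybar ⁻¹' {y}).indicator (fun _ => (1:ℝ)) ω * f y ω ∂μ
      = ε / K * ∫ ω, f y ω ∂μ := by
    intro y
    rw [indep_set_integral μ _ G (sup_le hU_meas.comap_le hYbar_meas.comap_le) hG hUYG _ ?_ _
      (hfm y), hPB]
    refine MeasurableSet.inter ?_ ?_
    · exact (le_sup_left : MeasurableSpace.comap U inferInstance ≤ _) _ ⟨_, measurableSet_Iio, rfl⟩
    · exact (le_sup_right : MeasurableSpace.comap Ybar inferInstance ≤ _) _
        ⟨_, measurableSet_singleton y, rfl⟩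
  have hpt : ∀ ω, W ω * (robustGrad α ε K (τ ω) (S (if ε ≤ U ω then Y ω else Ybar ω) ω)
      (fun y => S y ω) - ((if S (Y ω) ω ≤ τ ω then (1:ℝ) else 0) - (1 - α))) =
      (1 / (1 - ε)) * (A.indicator (fun _ => (1:ℝ)) ω * g ω +
        ∑ y, (A' ∩ Ybar ⁻¹' {y}).indicator (fun _ => (1:ℝ)) ω * f y ω)
      - (ε / ((K : ℝ) * (1 - ε))) * (∑ y, f y ω) - g ω := by
    intro ω
    rw [robustGrad_eq α ε K hK hε]
    have e1 : A.indicator (fun _ => (1:ℝ)) ω * g ω +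
        ∑ y, (A' ∩ Ybar ⁻¹' {y}).indicator (fun _ => (1:ℝ)) ω * f y ω =
        W ω * (if S (if ε ≤ U ω then Y ω else Ybar ω) ω ≤ τ ω then (1:ℝ) else 0) := by
      by_cases h : ε ≤ U ω
      · have h' : ¬ (U ω < ε) := not_lt.2 h
        simp [hA, hA', Set.indicator_apply, h, h', hg]
      · have h' : (U ω < ε) := not_le.1 h
        have e2 : ∀ y, (A' ∩ Ybar ⁻¹' {y}).indicator (fun _ => (1:ℝ)) ω =
            if Ybar ω = y then (1:ℝ) else 0 := by
          intro y
          by_cases hy : Ybar ω = y <;> simp [hA', Set.indicator_apply, h', hy]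
        have e3 : A.indicator (fun _ => (1:ℝ)) ω = 0 := by
          simp [hA, h']
        simp only [e2, e3, h, ite_mul, one_mul, zero_mul, if_false, zero_add, Finset.sum_ite_eq,
          Finset.mem_univ, if_true, hf]
    rw [e1, ← Finset.mul_sum]
    simp only [hg]
    ring
  simp_rw [hpt]
  have I1 : Integrable (fun ω => ∑ y, (A' ∩ Ybar ⁻¹' {y}).indicator (fun _ => (1:ℝ)) ω * f y ω) μ :=
    integrable_finsetSum _ fun y _ => hind _ (hBm y) _ (hfi y)
  have I2 : Integrable (fun ω => ∑ y, f y ω) μ := integrable_finsetSum _ fun y _ => hfi y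
  have I3 : Integrable (fun ω => (1 / (1 - ε)) * (A.indicator (fun _ => (1:ℝ)) ω * g ω +
        ∑ y, (A' ∩ Ybar ⁻¹' {y}).indicator (fun _ => (1:ℝ)) ω * f y ω)) μ :=
    ((hind A hAm g hgi).add I1).const_mul _
  have I4 : Integrable (fun ω => (ε / ((K : ℝ) * (1 - ε))) * (∑ y, f y ω)) μ := I2.const_mul _
  have I5 : Integrable (fun ω => (1 / (1 - ε)) * (A.indicator (fun _ => (1:ℝ)) ω * g ω +
        ∑ y, (A' ∩ Ybar ⁻¹' {y}).indicator (fun _ => (1:ℝ)) ω * f y ω)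
      - (ε / ((K : ℝ) * (1 - ε))) * (∑ y, f y ω)) μ := I3.sub I4
  rw [integral_sub I5 hgi, integral_sub I3 I4,
    integral_const_mul, integral_const_mul, integral_add (hind A hAm g hgi) I1, hi1,
    integral_finsetSum _ (fun y _ => hind _ (hBm y) _ (hfi y)),
    integral_finsetSum _ (fun y _ => hfi y)]
  simp_rw [hi2]
  rw [← Finset.mul_sum]
  have h1 : (1 - ε) ≠ 0 := by linarith [hε.2]
  have h2 : (K:ℝ) ≠ 0 := by positivity
  field_simp
  ring

/-- empirical coverage error bound for NR-OCP (online conformal prediction with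
robust pinball subgradient updates) under uniform label noise, constant learning rate. -/
theorem nrocp_empirical_coverage_error_constant_lr
    {Ω : Type*} {m0 : MeasurableSpace Ω} (μ : Measure Ω) [IsProbabilityMeasure μ]
    (F : Filtration ℕ m0)
    (K : ℕ) (hK : 1 ≤ K) (ε α : ℝ) (hε : ε ∈ Set.Ioo (0:ℝ) 1) (hα : α ∈ Set.Ioo (0:ℝ) 1)
    (S : ℕ → Fin K → Ω → ℝ) (Y : ℕ → Ω → Fin K) (U : ℕ → Ω → ℝ) (Ybar : ℕ → Ω → Fin K)
    -- measurability of the scores and labels with respect to the filtration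
    (hS_meas : ∀ t, 1 ≤ t → ∀ y, Measurable[F t] (S t y))
    (hS_range : ∀ t, 1 ≤ t → ∀ y ω, S t y ω ∈ Set.Icc (0:ℝ) 1)
    (hY_meas : ∀ t, 1 ≤ t → Measurable[F t] (Y t))
    (hU_meas : ∀ t, 1 ≤ t → Measurable[F t] (U t))
    (hYbar_meas : ∀ t, 1 ≤ t → Measurable[F t] (Ybar t))
    -- U_t is uniformly distributed on [0,1], Ȳ_t uniformly on {1,…,K}
    (hU_unif : ∀ t, 1 ≤ t → Measure.map (U t) μ = volume.restrict (Set.Icc (0:ℝ) 1))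
    (hYbar_unif : ∀ t, 1 ≤ t → ∀ y : Fin K, μ {ω | Ybar t ω = y} = (K : ENNReal)⁻¹)
    -- U_t, Ȳ_t and the σ-algebra generated by F_{t-1} together with (Y_t, S_{t,·})
    -- are mutually independent
    (hIndep : ∀ t, 1 ≤ t →
      iIndep
        ![MeasurableSpace.comap (U t) inferInstance,
          MeasurableSpace.comap (Ybar t) inferInstance,
          (F (t - 1) : MeasurableSpace Ω) ⊔
            MeasurableSpace.comap (fun ω => (Y t ω, fun y => S t y ω)) inferInstance] μ)
    -- the noisy labels
    (Ytil : ℕ → Ω → Fin K)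
    (hYtil : ∀ t, 1 ≤ t → ∀ ω, Ytil t ω = if ε ≤ U t ω then Y t ω else Ybar t ω)
    -- constant learning rate and deterministic initial threshold
    (η : ℝ) (hη : 0 < η) (τ0 : ℝ) (hτ0 : τ0 ∈ Set.Icc (0:ℝ) 1)
    (τ : ℕ → Ω → ℝ) (hτ1 : ∀ ω, τ 1 ω = τ0)
    -- NR-OCP update using the robust pinball subgradient
    (hupd : ∀ t, 1 ≤ t → ∀ ω,
      τ (t + 1) ω = τ t ω
        - η * robustGrad α ε K (τ t ω) (S t (Ytil t ω) ω) (fun y => S t y ω))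
    (δ : ℝ) (hδ : δ ∈ Set.Ioo (0:ℝ) 1) (T : ℕ) (hT : 1 ≤ T) :
    ENNReal.ofReal (1 - δ) ≤
      μ {ω |
        |(1 / (T : ℝ)) * (∑ t ∈ Finset.Icc 1 T,
              (if τ t ω < S t (Y t ω) ω then (1:ℝ) else 0))
            - α|
          ≤ ((2 - ε) / (1 - ε)) * Real.sqrt (2 * Real.log (4 / δ)) / Real.sqrt T
            + (1 / η + (1 + ε) / (1 - ε)) / T} := by
  have h1ε : 0 < 1 - ε := by linarith [hε.2]
  have hT0 : (0:ℝ) < T := by exact_mod_cast hT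
  have hYtilm : ∀ t, 1 ≤ t → Measurable[F t] (Ytil t) := by
    intro t ht
    have : Ytil t = fun ω => if ε ≤ U t ω then Y t ω else Ybar t ω := funext (hYtil t ht)
    rw [this]
    exact Measurable.ite (measurableSet_le measurable_const (hU_meas t ht)) (hY_meas t ht)
      (hYbar_meas t ht)
  have hgradm : ∀ t, 1 ≤ t → Measurable[F t] (τ t) → Measurable[F t] (fun ω =>
      robustGrad α ε K (τ t ω) (S t (Ytil t ω) ω) (fun y => S t y ω)) := by
    intro t ht hτ
    simp_rw [robustGrad_eq α ε K hK hε]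
    have h1 : Measurable[F t] (fun ω => S t (Ytil t ω) ω) :=
      meas_select _ _ (hYtilm t ht) (hS_meas t ht)
    refine Measurable.sub_const (Measurable.sub (Measurable.const_mul
      (Measurable.ite (measurableSet_le h1 hτ) measurable_const measurable_const) _)
      (Measurable.const_mul (Finset.measurable_fun_sum _ fun y _ =>
      Measurable.ite (measurableSet_le (hS_meas t ht y) hτ) measurable_const measurable_const) _)) _
  have hτm : ∀ n, Measurable[F n] (τ (n + 1)) := by
    intro n
    induction n with
    | zero =>
      have : τ (0 + 1) = fun _ => τ0 := funext hτ1
      rw [this]; exact measurable_const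
    | succ n ih =>
      have ih' : Measurable[F (n+1)] (τ (n+1)) := ih.mono (F.mono (Nat.le_succ n)) le_rfl
      have : τ (n + 1 + 1) = _ := funext (hupd (n+1) (by omega))
      rw [this]
      exact ih'.sub ((hgradm (n+1) (by omega) ih').const_mul η)
  have hτm' : ∀ t, 1 ≤ t → Measurable[F (t-1)] (τ t) := by
    intro t ht
    obtain ⟨n, rfl⟩ : ∃ n, t = n + 1 := ⟨t - 1, by omega⟩
    exact hτm n
  have hτm'' : ∀ t, 1 ≤ t → Measurable[F t] (τ t) := fun t ht =>
    (hτm' t ht).mono (F.mono (Nat.sub_le t 1)) le_rfl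
  set D : ℕ → Ω → ℝ := fun t ω =>
    robustGrad α ε K (τ t ω) (S t (Ytil t ω) ω) (fun y => S t y ω)
      - ((if S t (Y t ω) ω ≤ τ t ω then (1:ℝ) else 0) - (1 - α)) with hD
  have hDm : ∀ t, 1 ≤ t → Measurable[F t] (D t) := by
    intro t ht
    refine (hgradm t ht (hτm'' t ht)).sub (Measurable.sub_const (Measurable.ite
      (measurableSet_le (meas_select _ _ (hY_meas t ht) (hS_meas t ht)) (hτm'' t ht))
      measurable_const measurable_const) _)
  have hDb : ∀ t, 1 ≤ t → ∀ ω, |D t ω| ≤ (2 - ε) / (1 - ε) := fun t ht ω =>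
    diff_bound α ε K hK hε _ _ _ _
  have hDz : ∀ t, 1 ≤ t → ∀ W : Ω → ℝ, Measurable[F (t-1)] W → (∃ C, ∀ ω, |W ω| ≤ C) →
      ∫ ω, W ω * D t ω ∂μ = 0 := by
    rintro t ht W hW ⟨C, hC⟩
    have hpair : Measurable[MeasurableSpace.comap (fun ω => (Y t ω, fun y => S t y ω)) inferInstance]
        (fun ω => (Y t ω, fun y => S t y ω)) := comap_measurable _
    have hYS : Measurable[F t] (fun ω => (Y t ω, fun y => S t y ω)) :=
      pair_meas _ _ (hY_meas t ht) (hS_meas t ht)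
    have hG : (F (t - 1) : MeasurableSpace Ω) ⊔
            MeasurableSpace.comap (fun ω => (Y t ω, fun y => S t y ω)) inferInstance ≤ m0 :=
      sup_le (F.le _) (hYS.comap_le.trans (F.le t))
    have := zero_mean _ μ hG K hK ε α hε (S t) (Y t) (U t) (Ybar t)
      (fun y => ((measurable_pi_apply y).comp (measurable_snd.comp hpair)).mono le_sup_right le_rfl)
      ((measurable_fst.comp hpair).mono le_sup_right le_rfl)
      ((hU_meas t ht).mono (F.le t) le_rfl) ((hYbar_meas t ht).mono (F.le t) le_rfl)
      (hU_unif t ht) (hYbar_unif t ht) (hIndep t ht) (τ t)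
      ((hτm' t ht).mono le_sup_left le_rfl) W (hW.mono le_sup_left le_rfl) C hC
    simp only [hD, hYtil t ht]
    exact this
  have hc : 0 < (2 - ε) / (1 - ε) := div_pos (by linarith) h1ε
  -- the threshold stays bounded
  have hτb : ∀ n ω, -(η * (1 / (1 - ε))) ≤ τ (n+1) ω ∧ τ (n+1) ω ≤ 1 + η * (1 / (1 - ε)) := by
    intro n ω
    have hB : 0 < η * (1 / (1 - ε)) := by positivity
    induction n with
    | zero => rw [hτ1]; constructor <;> linarith [hτ0.1, hτ0.2]
    | succ n ih =>
      rw [hupd (n+1) (by omega)]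
      have hr := fun y => hS_range (n+1) (by omega) y ω
      have hb := abs_le.1 (robustGrad_bound α ε K hK hε hα (τ (n+1) ω)
        (S (n+1) (Ytil (n+1) ω) ω) (fun y => S (n+1) y ω))
      have hb1 := mul_le_mul_of_nonneg_left hb.1 hη.le
      have hb2 := mul_le_mul_of_nonneg_left hb.2 hη.le
      rcases lt_or_ge (τ (n+1) ω) 0 with h | h
      · have e := robustGrad_low α ε K hK hε _ (fun y => S (n+1) y ω) (Ytil (n+1) ω) hr h
        have : 0 < η * (1 - α) := mul_pos hη (by linarith [hα.2])
        constructor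
        · rw [e]; linarith [ih.1, ih.2]
        · linarith
      · rcases lt_or_ge 1 (τ (n+1) ω) with h' | h'
        · have e := robustGrad_high α ε K hK hε _ (fun y => S (n+1) y ω) (Ytil (n+1) ω) hr h'
          have : 0 < η * α := mul_pos hη hα.1
          constructor
          · linarith
          · rw [e]; linarith [ih.1, ih.2]
        · constructor <;> linarith
  -- telescoping
  have htel : ∀ n ω, η * ∑ t ∈ Finset.Icc 1 n,
      robustGrad α ε K (τ t ω) (S t (Ytil t ω) ω) (fun y => S t y ω) = τ0 - τ (n+1) ω := by
    intro n ω
    induction n with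
    | zero => simp [hτ1]
    | succ n ih =>
      rw [Finset.sum_Icc_succ_top (by omega), mul_add, ih, hupd (n+1) (by omega)]
      ring
  have hsumb : ∀ ω, |∑ t ∈ Finset.Icc 1 T,
      robustGrad α ε K (τ t ω) (S t (Ytil t ω) ω) (fun y => S t y ω)|
        ≤ 1 / η + (1 + ε) / (1 - ε) := by
    intro ω
    have h1 := htel T ω
    have h2 := hτb T ω
    have h3 : |η * ∑ t ∈ Finset.Icc 1 T,
      robustGrad α ε K (τ t ω) (S t (Ytil t ω) ω) (fun y => S t y ω)| ≤ 1 + η * (1 / (1 - ε)) := by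
      rw [h1, abs_le]; constructor <;> linarith [hτ0.1, hτ0.2]
    rw [abs_mul, abs_of_pos hη] at h3
    have h4 : 1 / (1 - ε) ≤ (1 + ε) / (1 - ε) := by gcongr; linarith [hε.1]
    have h5 : |∑ t ∈ Finset.Icc 1 T,
      robustGrad α ε K (τ t ω) (S t (Ytil t ω) ω) (fun y => S t y ω)| ≤ (1 + η * (1 / (1 - ε))) / η := by
      rw [le_div_iff₀ hη]; linarith
    have h6 : (1 + η * (1 / (1 - ε))) / η = 1 / η + 1 / (1 - ε) := by field_simp
    linarith
  set c := (2 - ε) / (1 - ε) with hcdef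
  have hlog : 0 < Real.log (4 / δ) := Real.log_pos (by
    rw [lt_div_iff₀ hδ.1]; linarith [hδ.2])
  set x := c * Real.sqrt (2 * Real.log (4 / δ)) * Real.sqrt T with hx
  have hx0 : 0 ≤ x := by positivity
  have htail := azuma_tail μ F D c hc hDm hDb hDz T x hx0
  have hexp : 2 * Real.exp (-x^2 / (2 * (T * c^2))) = δ / 2 := by
    have : -x^2 / (2 * (T * c^2)) = - Real.log (4 / δ) := by
      rw [hx, mul_pow, mul_pow, Real.sq_sqrt (by positivity), Real.sq_sqrt hT0.le]
      field_simp
    rw [this, Real.exp_neg, Real.exp_log (by have := hδ.1; positivity)]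
    have := hδ.1
    field_simp
    norm_num
  rw [hexp] at htail
  have hDsm : Measurable (fun ω => ∑ t ∈ Finset.Icc 1 T, D t ω) :=
    Finset.measurable_fun_sum _ fun t ht =>
      (hDm t (Finset.mem_Icc.1 ht).1).mono (F.le t) le_rfl
  have hbadm : MeasurableSet {ω | x ≤ |∑ t ∈ Finset.Icc 1 T, D t ω|} :=
    measurableSet_le measurable_const hDsm.abs
  have hgood : ENNReal.ofReal (1 - δ) ≤ μ {ω | x ≤ |∑ t ∈ Finset.Icc 1 T, D t ω|}ᶜ := by
    rw [← ofReal_measureReal, probReal_compl_eq_one_sub hbadm]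
    apply ENNReal.ofReal_le_ofReal
    linarith [hδ.1]
  refine hgood.trans (measure_mono ?_)
  intro ω hω
  simp only [Set.mem_compl_iff, Set.mem_ofPred_eq, not_le] at hω ⊢
  have hid : (1 / (T : ℝ)) * (∑ t ∈ Finset.Icc 1 T,
      (if τ t ω < S t (Y t ω) ω then (1:ℝ) else 0)) - α =
      (∑ t ∈ Finset.Icc 1 T, D t ω - ∑ t ∈ Finset.Icc 1 T,
        robustGrad α ε K (τ t ω) (S t (Ytil t ω) ω) (fun y => S t y ω)) / T := by
    rw [← Finset.sum_sub_distrib]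
    have : ∀ t, D t ω - robustGrad α ε K (τ t ω) (S t (Ytil t ω) ω) (fun y => S t y ω) =
        (if τ t ω < S t (Y t ω) ω then (1:ℝ) else 0) - α := by
      intro t
      simp only [hD]
      by_cases h : τ t ω < S t (Y t ω) ω
      · have h' := not_le.2 h
        simp only [h, h', if_true, if_false]; ring
      · have h' := not_lt.1 h
        simp only [h, h', if_true, if_false]; ring
    simp_rw [this]
    rw [Finset.sum_sub_distrib]
    simp only [Finset.sum_const, Nat.card_Icc, Nat.add_sub_cancel, nsmul_eq_mul]
    field_simp
  rw [hid, abs_div, abs_of_pos hT0, div_le_iff₀ hT0, add_mul, div_mul_cancel₀ _ hT0.ne']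
  have hxT : c * Real.sqrt (2 * Real.log (4 / δ)) / Real.sqrt T * T = x := by
    have hsq : Real.sqrt T * Real.sqrt T = T := Real.mul_self_sqrt hT0.le
    have hs0 : Real.sqrt T ≠ 0 := (Real.sqrt_pos.2 hT0).ne'
    rw [hx, div_mul_eq_mul_div, div_eq_iff hs0, mul_assoc _ (Real.sqrt T), hsq]
  rw [hxT]
  exact (abs_sub _ _).trans (add_le_add hω.le (hsumb ω))
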